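/- Let F be a field of characteristic zero and let L be a left Leibniz algebra over F. Then L is finite-dimensional and Lie-simple if, and only if, there exist a finite-dimensional simple Lie algebra g over F and a finite-dimensional completely reducible left g-module M containing no non-zero trivial g-submodule such that L is isomorphic to the left hemi-semidirect product g ⋉_ℓ M (i.e., there is an F-linear bijection L → g × M carrying the multiplication of L to the multiplication of g ⋉_ℓ M). -/

import Mathlib

universe u v w

section LeibnizDefs

variable (F : Type v) [Field F] {L : Type u} [AddCommGroup L] [Module F L]

/-- The Leibniz kernel `Leib(L) = span_F {x² : x ∈ L}` of a (Leibniz) multiplication. -/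
def leibKer (mul : L → L → L) : Submodule F L :=
  Submodule.span F {z : L | ∃ x : L, z = mul x x}

/-- The derived subalgebra `L² = span_F {xy : x, y ∈ L}`. -/
def derivedSub (mul : L → L → L) : Submodule F L :=
  Submodule.span F {z : L | ∃ x y : L, z = mul x y}

/-- A (two-sided) ideal of an algebra with multiplication `mul`. -/
def IsIdealOf (mul : L → L → L) (I : Submodule F L) : Prop :=
  ∀ x : L, ∀ a ∈ I, mul x a ∈ I ∧ mul a x ∈ I

/-- The derived series of a subspace: `I⁽⁰⁾ = I`, `I⁽ⁿ⁺¹⁾ = span {ab : a, b ∈ I⁽ⁿ⁾}`. -/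
def derSeries (mul : L → L → L) (I : Submodule F L) : ℕ → Submodule F L
  | 0 => I
  | n + 1 => Submodule.span F
      {z : L | ∃ a ∈ derSeries mul I n, ∃ b ∈ derSeries mul I n, z = mul a b}

/-- A subspace is solvable if its derived series vanishes eventually. -/
def IsSolvableSub (mul : L → L → L) (I : Submodule F L) : Prop :=
  ∃ n : ℕ, derSeries F mul I n = ⊥

/-- A left Leibniz algebra is semi-simple if every solvable ideal is contained
in its Leibniz kernel. -/
def IsSemisimpleLeibniz (mul : L → L → L) : Prop :=
  ∀ I : Submodule F L, IsIdealOf F mul I → IsSolvableSub F mul I → I ≤ leibKer F mul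

/-- A left Leibniz algebra is Lie-simple if the only ideals containing `Leib(L)`
are `Leib(L)` and `L`, and `Leib(L) ⊊ L²`. -/
def IsLieSimpleLeibniz (mul : L → L → L) : Prop :=
  (∀ I : Submodule F L, IsIdealOf F mul I → leibKer F mul ≤ I →
      I = leibKer F mul ∨ I = ⊤) ∧ leibKer F mul < derivedSub F mul

/-- A left Leibniz algebra is simple if its only ideals are `0`, `Leib(L)` and `L`,
and `Leib(L) ⊊ L²`. -/
def IsSimpleLeibniz (mul : L → L → L) : Prop :=
  (∀ I : Submodule F L, IsIdealOf F mul I →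
      I = ⊥ ∨ I = leibKer F mul ∨ I = ⊤) ∧ leibKer F mul < derivedSub F mul

/-- A non-abelian algebra whose only ideals are `0` and the whole algebra. -/
def IsSimpleMul (mul : L → L → L) : Prop :=
  (∃ x y : L, mul x y ≠ 0) ∧
  ∀ I : Submodule F L, IsIdealOf F mul I → I = ⊥ ∨ I = ⊤

/-- The multiplication is bilinear over `F`. -/
def IsBilinearMul (mul : L → L → L) : Prop :=
  (∀ x y z : L, mul (x + y) z = mul x z + mul y z) ∧
  (∀ x y z : L, mul x (y + z) = mul x y + mul x z) ∧
  (∀ (c : F) (x y : L), mul (c • x) y = c • mul x y) ∧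
  (∀ (c : F) (x y : L), mul x (c • y) = c • mul x y)

/-- The left Leibniz identity `x(yz) = (xy)z + y(xz)`. -/
def IsLeftLeibnizMul (mul : L → L → L) : Prop :=
  ∀ x y z : L, mul x (mul y z) = mul (mul x y) z + mul y (mul x z)

end LeibnizDefs

section LieDefs

variable (F : Type v) [Field F] (g : Type u) [LieRing g] [LieAlgebra F g]

/-- A Lie algebra is semi-simple if its only solvable ideal is `0`. -/
def IsSemisimpleLieDef : Prop :=
  ∀ I : Submodule F g, IsIdealOf F (fun x y : g => ⁅x, y⁆) I →
    IsSolvableSub F (fun x y : g => ⁅x, y⁆) I → I = ⊥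

/-- A Lie algebra is simple if it is non-abelian and its only ideals are `0` and `g`. -/
def IsSimpleLieDef : Prop :=
  IsSimpleMul F (fun x y : g => ⁅x, y⁆)

end LieDefs

section ModuleDefs

variable (F : Type v) [Field F] (g : Type u) [LieRing g] [LieAlgebra F g]
  (M : Type w) [AddCommGroup M] [Module F M] [LieRingModule g M] [LieModule F g M]

/-- `gM := span_F {x·m : x ∈ g, m ∈ M}`. -/
def gModSpan : Submodule F M :=
  Submodule.span F {m : M | ∃ (x : g) (n : M), m = ⁅x, n⁆}

/-- A subspace of `M` that is stable under the `g`-action. -/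
def IsLieSubmoduleOf (N : Submodule F M) : Prop :=
  ∀ x : g, ∀ n ∈ N, ⁅x, n⁆ ∈ N

/-- `M` is an irreducible `g`-module: `M ≠ 0` and its only `g`-submodules are `0` and `M`. -/
def IsIrreducibleLieModule : Prop :=
  (∃ m : M, m ≠ 0) ∧
  ∀ N : Submodule F M, IsLieSubmoduleOf F g M N → N = ⊥ ∨ N = ⊤

/-- `M` is completely reducible: every `g`-submodule has a `g`-invariant complement. -/
def IsCompletelyReducibleLieModule : Prop :=
  ∀ N : Submodule F M, IsLieSubmoduleOf F g M N →
    ∃ N' : Submodule F M, IsLieSubmoduleOf F g M N' ∧ N ⊓ N' = ⊥ ∧ N ⊔ N' = ⊤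

/-- `M` contains no non-zero trivial `g`-submodule. -/
def HasNoTrivialLieSubmodule : Prop :=
  ∀ N : Submodule F M, IsLieSubmoduleOf F g M N →
    (∀ x : g, ∀ n ∈ N, ⁅x, n⁆ = (0 : M)) → N = ⊥

end ModuleDefs

/-- The multiplication `(x, m)(y, n) := ([x, y], x·n)` of the left hemi-semidirect
product `g ⋉_ℓ M`. -/
def hemiMul {g : Type u} {M : Type w} [LieRing g] [AddCommGroup M]
    [LieRingModule g M] (a b : g × M) : g × M :=
  (⁅a.1, b.1⁆, ⁅a.1, b.2⁆)

section Weyl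

theorem lie_sum' {g : Type*} [LieRing g] {V : Type*} [AddCommGroup V] [LieRingModule g V]
    {ι : Type*} (s : Finset ι) (f : ι → V) (x : g) : ⁅x, ∑ i ∈ s, f i⁆ = ∑ i ∈ s, ⁅x, f i⁆ := by
  classical
  induction s using Finset.induction_on with
  | empty => simp
  | insert a s ha ih => simp [Finset.sum_insert ha, ih]

variable {F : Type v} [Field F] [CharZero F] {g : Type u} [LieRing g] [LieAlgebra F g]
  [FiniteDimensional F g]

theorem casimir_aux (B : LinearMap.BilinForm F g) (hB : B.Nondegenerate) (hS : B.IsSymm)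
    (hinv : ∀ x y z : g, B ⁅x, y⁆ z = - B y ⁅x, z⁆)
    {ι : Type*} [Fintype ι] [DecidableEq ι] (b : Module.Basis ι F g)
    {W : Type*} [AddCommGroup W] [Module F W] (T : g →ₗ[F] g →ₗ[F] W) (x : g) :
    ∑ i, T ⁅x, b i⁆ (B.dualBasis hB b i) + ∑ i, T (b i) ⁅x, B.dualBasis hB b i⁆ = 0 := by
  set c := B.dualBasis hB b with hc
  have h1 : ∀ y, y = ∑ j, B (c j) y • b j := by
    intro y
    conv_lhs => rw [← b.sum_repr y]
    refine Finset.sum_congr rfl fun j _ => ?_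
    congr 1
    have : ∀ i, B (c j) (b i) = if i = j then 1 else 0 := by
      intro i; rw [hc, LinearMap.BilinForm.apply_dualBasis_left]
    conv_rhs => rw [← b.sum_repr y]
    rw [map_sum]
    simp [this]
  have h2 : ∀ y, y = ∑ j, B y (b j) • c j := by
    intro y
    conv_lhs => rw [← c.sum_repr y]
    refine Finset.sum_congr rfl fun j _ => ?_
    congr 1
    simp [hc, LinearMap.BilinForm.dualBasis_repr_apply]
  have e1 : ∑ i, T ⁅x, b i⁆ (c i) = ∑ i, ∑ j, B (c j) ⁅x, b i⁆ • T (b j) (c i) := by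
    refine Finset.sum_congr rfl fun i _ => ?_
    conv_lhs => rw [h1 ⁅x, b i⁆]
    simp
  have e2 : ∑ i, T (b i) ⁅x, c i⁆ = ∑ i, ∑ j, B ⁅x, c i⁆ (b j) • T (b i) (c j) := by
    refine Finset.sum_congr rfl fun i _ => ?_
    conv_lhs => rw [h2 ⁅x, c i⁆]
    simp
  rw [e1, e2, Finset.sum_comm, ← Finset.sum_add_distrib]
  refine Finset.sum_eq_zero fun i _ => ?_
  rw [← Finset.sum_add_distrib]
  refine Finset.sum_eq_zero fun j _ => ?_
  rw [hinv]; simp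

theorem simple_perfect [LieAlgebra.IsSimple F g] : LieAlgebra.derivedSeries F g 1 = ⊤ := by
  rcases LieAlgebra.IsSimple.eq_bot_or_eq_top (R := F) (LieAlgebra.derivedSeries F g 1) with h | h
  · exfalso
    apply LieAlgebra.IsSimple.non_abelian F (L := g)
    constructor
    intro x y
    have : ⁅x, y⁆ ∈ LieAlgebra.derivedSeries F g 1 := by
      rw [LieAlgebra.derivedSeries_def, LieAlgebra.derivedSeriesOfIdeal_succ]
      exact LieSubmodule.lie_mem_lie (by simp) (by simp)
    rw [h] at this
    simpa using this
  · exact h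

theorem cocycle_irred [LieAlgebra.IsSimple F g] {V : Type w} [AddCommGroup V] [Module F V]
    [LieRingModule g V] [LieModule F g V] [FiniteDimensional F V]
    (hV : ∀ N : LieSubmodule F g V, N = ⊥ ∨ N = ⊤)
    (f : g →ₗ[F] V) (hf : ∀ x y, f ⁅x, y⁆ = ⁅x, f y⁆ - ⁅y, f x⁆) :
    ∃ v, ∀ x, f x = ⁅x, v⁆ := by
  classical
  by_cases htriv : ∀ (x : g) (v : V), ⁅x, v⁆ = 0
  · refine ⟨0, fun x => ?_⟩
    have : LieAlgebra.derivedSeries F g 1 ≤ (LieAlgebra.derivedSeries F g 1) := le_rfl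
    have hx : x ∈ LieAlgebra.derivedSeries F g 1 := by rw [simple_perfect]; simp
    rw [LieAlgebra.derivedSeries_def, LieAlgebra.derivedSeriesOfIdeal_succ,
      ← LieSubmodule.mem_toSubmodule, LieSubmodule.lieIdeal_oper_eq_linear_span'] at hx
    rw [lie_zero]
    have : Submodule.span F {m : g | ∃ x ∈ LieAlgebra.derivedSeriesOfIdeal F g 0 ⊤,
        ∃ n ∈ LieAlgebra.derivedSeriesOfIdeal F g 0 ⊤, ⁅x, n⁆ = m} ≤ LinearMap.ker f := by
      rw [Submodule.span_le]
      rintro _ ⟨a, -, b, -, rfl⟩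
      simp [hf, htriv]
    exact this hx
  have hntV : Nontrivial V := by
    by_contra h
    rw [not_nontrivial_iff_subsingleton] at h
    exact htriv fun x v => Subsingleton.elim _ _
  have hB0 : LieModule.traceForm F g V ≠ 0 := by
    intro h0
    have h1 := LieModule.isNilpotent_derivedSeries_of_traceForm_eq_zero h0
    have h2 : LieModule.IsNilpotent g V := by
      rw [LieModule.isNilpotent_iff_forall' (R := F)] at h1 ⊢
      intro x
      exact h1 ⟨x, by rw [simple_perfect]; simp⟩
    have h3 := LieModule.nontrivial_max_triv_of_isNilpotent F g V
    rcases hV (LieModule.maxTrivSubmodule F g V) with h | h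
    · rw [h] at h3
      exact not_subsingleton (⊥ : LieSubmodule F g V) inferInstance
    · apply htriv
      intro x v
      have : v ∈ LieModule.maxTrivSubmodule F g V := by rw [h]; simp
      exact this x
  set B := LieModule.traceForm F g V with hBdef
  have hS : B.IsSymm := ⟨LieModule.traceForm_comm F g V⟩
  have hinv : ∀ x y z : g, B ⁅x, y⁆ z = - B y ⁅x, z⁆ := LieModule.traceForm_lieInvariant F g V
  have hker : LinearMap.ker B = ⊥ := by
    let I : LieIdeal F g :=
      { LinearMap.ker B with
        lie_mem := by
          intro x m hm
          have hm : B m = 0 := hm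
          change B ⁅x, m⁆ = 0
          ext z
          rw [hinv, hm]; simp }
    rcases LieAlgebra.IsSimple.eq_bot_or_eq_top (R := F) I with h | h
    · have := congrArg LieSubmodule.toSubmodule h
      simpa [I] using this
    · exfalso
      apply hB0
      ext x y
      have : x ∈ I := by rw [h]; simp
      have : B x = 0 := this
      simp [this]
  have hB : B.Nondegenerate := by
    refine hS.isRefl.nondegenerate_iff_separatingLeft.mpr ?_
    rwa [LinearMap.separatingLeft_iff_ker_eq_bot]
  let b := Module.finBasis F g
  set c := B.dualBasis hB b with hc
  let φ := LieModule.toEnd F g V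
  let C : V →ₗ[F] V := ∑ i, φ (b i) ∘ₗ φ (c i)
  have hC : ∀ v, C v = ∑ i, ⁅b i, ⁅c i, v⁆⁆ := by
    intro v; simp [C, φ]
  have hCx : ∀ (x : g) (v : V), C ⁅x, v⁆ = ⁅x, C v⁆ := by
    intro x v
    let T : g →ₗ[F] g →ₗ[F] V := LinearMap.mk₂ F (fun y z => ⁅y, ⁅z, v⁆⁆)
      (by simp) (by simp) (by simp) (by simp)
    have := casimir_aux B hB hS hinv b T x
    simp only [T, LinearMap.mk₂_apply, ← hc] at this
    rw [← Finset.sum_add_distrib] at this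
    rw [hC, hC, ← sub_eq_zero, lie_sum', ← neg_eq_zero, ← this, ← Finset.sum_sub_distrib,
      ← Finset.sum_neg_distrib]
    refine Finset.sum_congr rfl fun i _ => ?_
    simp only [lie_lie, lie_sub]
    abel
  have htr : LinearMap.trace F V C ≠ 0 := by
    have : LinearMap.trace F V C = ∑ i, B (b i) (c i) := by
      simp [C, hBdef, LieModule.traceForm_apply_apply, φ]
    rw [this]
    have h1 : ∀ i, B (b i) (c i) = 1 := by
      intro i
      rw [hc, LinearMap.BilinForm.apply_dualBasis_right hB hS]; simp
    have hnt : Nontrivial g := by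
      by_contra h
      rw [not_nontrivial_iff_subsingleton] at h
      exact htriv fun x v => by rw [Subsingleton.elim x 0, zero_lie]
    simp [h1, Module.finrank_pos.ne']
  have hCinj : LinearMap.ker C = ⊥ := by
    let N : LieSubmodule F g V :=
      { LinearMap.ker C with
        lie_mem := by
          intro x m hm
          have hm : C m = 0 := hm
          change C ⁅x, m⁆ = 0
          rw [hCx, hm, lie_zero] }
    rcases hV N with h | h
    · have := congrArg LieSubmodule.toSubmodule h
      simpa [N] using this
    · exfalso
      apply htr
      have : C = 0 := by
        ext v
        have : v ∈ N := by rw [h]; simp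
        exact this
      simp [this]
  have hCsurj : Function.Surjective C :=
    LinearMap.injective_iff_surjective.mp (LinearMap.ker_eq_bot.mp hCinj)
  obtain ⟨v, hv⟩ := hCsurj (∑ i, ⁅b i, f (c i)⁆)
  refine ⟨v, fun x => LinearMap.ker_eq_bot.mp hCinj ?_⟩
  rw [hCx, hv, hC, lie_sum']
  let T : g →ₗ[F] g →ₗ[F] V := LinearMap.mk₂ F (fun y z => ⁅y, f z⁆)
      (by simp) (by simp) (by simp) (by simp)
  have := casimir_aux B hB hS hinv b T x
  simp only [T, LinearMap.mk₂_apply, ← hc] at this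
  rw [← Finset.sum_add_distrib] at this
  rw [← sub_eq_zero, ← neg_eq_zero, ← this, ← Finset.sum_sub_distrib,
      ← Finset.sum_neg_distrib]
  refine Finset.sum_congr rfl fun i _ => ?_
  simp only [hf, lie_lie, lie_sub]
  abel

theorem cocycle_inner [LieAlgebra.IsSimple F g] (n : ℕ) : ∀ (V : Type w) [AddCommGroup V]
    [Module F V] [LieRingModule g V] [LieModule F g V] [FiniteDimensional F V]
    (_ : Module.finrank F V ≤ n)
    (f : g →ₗ[F] V) (_ : ∀ x y, f ⁅x, y⁆ = ⁅x, f y⁆ - ⁅y, f x⁆),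
    ∃ v, ∀ x, f x = ⁅x, v⁆ := by
  induction n with
  | zero =>
    intro V _ _ _ _ _ h f hf
    have : Subsingleton V := Module.finrank_zero_iff.mp (Nat.le_zero.mp h)
    exact ⟨0, fun x => Subsingleton.elim _ _⟩
  | succ n ih =>
    intro V _ _ _ _ _ h f hf
    by_cases hV : ∀ N : LieSubmodule F g V, N = ⊥ ∨ N = ⊤
    · exact cocycle_irred hV f hf
    push Not at hV
    obtain ⟨N, hb, ht⟩ := hV
    have hb' : N.toSubmodule ≠ ⊥ := by simpa using hb
    have ht' : N.toSubmodule ≠ ⊤ := by simpa using ht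
    have hlt := Submodule.finrank_lt ht'
    have hpos := Submodule.one_le_finrank_iff.mpr hb'
    have hq := Submodule.finrank_quotient_add_finrank N.toSubmodule
    let π := LieSubmodule.Quotient.mk' N
    have hπ : ∀ v, π v = 0 ↔ v ∈ N := fun v => LieSubmodule.Quotient.mk_eq_zero N
    have : FiniteDimensional F (V ⧸ N) := inferInstanceAs (FiniteDimensional F (V ⧸ N.toSubmodule))
    have hd : Module.finrank F (V ⧸ N) ≤ n := by
      change Module.finrank F (V ⧸ N.toSubmodule) ≤ n
      omega
    obtain ⟨w, hw⟩ := ih (V ⧸ N) hd ((π : V →ₗ[F] V ⧸ N) ∘ₗ f) (by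
      intro x y
      simp [hf])
    obtain ⟨v, rfl⟩ := LieSubmodule.Quotient.surjective_mk' N w
    have hmem : ∀ x, f x - ⁅x, v⁆ ∈ N := by
      intro x
      rw [← hπ, map_sub, sub_eq_zero]
      rw [LieModuleHom.map_lie]
      exact hw x
    let f' : g →ₗ[F] N :=
      { toFun := fun x => ⟨f x - ⁅x, v⁆, hmem x⟩
        map_add' := by intro x y; ext; simp; abel
        map_smul' := by intro x y; ext; simp [smul_sub] }
    have : FiniteDimensional F N := inferInstanceAs (FiniteDimensional F N.toSubmodule)
    obtain ⟨u, hu⟩ := ih N (by change Module.finrank F N.toSubmodule ≤ n; omega) f' (by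
      intro x y
      ext
      simp [f', hf]
      abel)
    refine ⟨u + v, fun x => ?_⟩
    have := congrArg Subtype.val (hu x)
    simp [f'] at this
    rw [lie_add, ← this]; abel

theorem weyl_proj [LieAlgebra.IsSimple F g] {V : Type w} [AddCommGroup V] [Module F V]
    [LieRingModule g V] [LieModule F g V] [FiniteDimensional F V]
    (N : Submodule F V) (hN : IsLieSubmoduleOf F g V N) :
    ∃ p : V →ₗ[F] V, (∀ v, p v ∈ N) ∧ (∀ v ∈ N, p v = v) ∧ ∀ (x : g) v, p ⁅x, v⁆ = ⁅x, p v⁆ := by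
  obtain ⟨p0, hp0⟩ := N.subtype.exists_leftInverse_of_injective (by simp)
  let P : V →ₗ[F] V := N.subtype ∘ₗ p0
  have hP1 : ∀ v, P v ∈ N := fun v => (p0 v).2
  have hP2 : ∀ v ∈ N, P v = v := by
    intro v hv
    have := LinearMap.congr_fun hp0 ⟨v, hv⟩
    simpa [P] using congrArg Subtype.val this
  let E : LieSubmodule F g (V →ₗ[F] V) :=
    { carrier := {q | (∀ v, q v ∈ N) ∧ ∀ v ∈ N, q v = 0}
      add_mem' := by
        rintro a b ⟨h1, h2⟩ ⟨h3, h4⟩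
        exact ⟨fun v => N.add_mem (h1 v) (h3 v), fun v hv => by simp [h2 v hv, h4 v hv]⟩
      zero_mem' := by simp
      smul_mem' := by
        rintro c a ⟨h1, h2⟩
        exact ⟨fun v => N.smul_mem c (h1 v), fun v hv => by simp [h2 v hv]⟩
      lie_mem := by
        rintro x q ⟨h1, h2⟩
        refine ⟨fun v => ?_, fun v hv => ?_⟩
        · rw [LieHom.lie_apply]
          exact N.sub_mem (hN _ _ (h1 _)) (h1 _)
        · rw [LieHom.lie_apply, h2 v hv, h2 _ (hN x v hv)]; simp }
  let f : g →ₗ[F] E :=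
    { toFun := fun x => ⟨⁅x, P⁆, by
        refine ⟨fun v => ?_, fun v hv => ?_⟩
        · rw [LieHom.lie_apply]
          exact N.sub_mem (hN _ _ (hP1 _)) (hP1 _)
        · rw [LieHom.lie_apply, hP2 v hv, hP2 _ (hN x v hv)]; simp⟩
      map_add' := by intro x y; ext1; simp
      map_smul' := by intro x y; ext1; simp }
  have : FiniteDimensional F E := inferInstanceAs (FiniteDimensional F E.toSubmodule)
  obtain ⟨q, hq⟩ := cocycle_inner (g := g) _ E le_rfl f (by
    intro x y
    ext1
    simp [f])
  have hq1 := q.2.1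
  have hq2 := q.2.2
  refine ⟨P - q.1, fun v => N.sub_mem (hP1 v) (hq1 v), fun v hv => ?_, fun x v => ?_⟩
  · simp [hP2 v hv, hq2 v hv]
  · have := LinearMap.congr_fun (congrArg Subtype.val (hq x)) v
    simp only [f, LinearMap.coe_mk, AddHom.coe_mk, LieSubmodule.coe_bracket, LieHom.lie_apply] at this
    simp only [LinearMap.sub_apply, lie_sub]
    rw [sub_eq_sub_iff_sub_eq_sub, ← neg_inj, neg_sub, neg_sub, this]

end Weyl

section Construct

theorem hom_quot {F : Type v} [Field F]
    {L : Type u} [AddCommGroup L] [Module F L] (mul : L → L → L)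
    (hbil : IsBilinearMul F mul) (hleib : IsLeftLeibnizMul mul) :
    ∃ (g : Type u) (_ : LieRing g) (_ : LieAlgebra F g) (_ : LieRingModule g L)
      (_ : LieModule F g L) (π : L →ₗ[F] g), Function.Surjective π ∧
      LinearMap.ker π = leibKer F mul ∧ (∀ x y, ⁅π x, y⁆ = mul x y) ∧
      ∀ x y, π (mul x y) = ⁅π x, π y⁆ := by
  obtain ⟨hal, har, hsl, hsr⟩ := hbil
  let m : L →ₗ[F] L →ₗ[F] L := LinearMap.mk₂ F mul hal hsl har hsr
  have hm : ∀ x y, m x y = mul x y := fun x y => rfl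
  have hL : ∀ x y z, m x (m y z) = m (m x y) z + m y (m x z) := hleib
  set K := leibKer F mul with hK
  have hsq : ∀ x, m x x ∈ K := fun x => Submodule.subset_span ⟨x, rfl⟩
  have hsym : ∀ x y, m x y + m y x ∈ K := by
    intro x y
    have : m x y + m y x = m (x + y) (x + y) - m x x - m y y := by
      simp only [map_add, LinearMap.add_apply]; abel
    rw [this]
    exact K.sub_mem (K.sub_mem (hsq _) (hsq _)) (hsq _)
  have hK0 : K ≤ LinearMap.ker m := by
    rw [hK, leibKer, Submodule.span_le]
    rintro _ ⟨x, rfl⟩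
    have : m (m x x) = 0 := by
      ext y
      have := hL x x y
      simpa using this
    exact this
  have hKs : ∀ x, K ≤ K.comap (m x) := by
    intro x
    conv_lhs => rw [hK, leibKer]
    rw [Submodule.span_le]
    rintro _ ⟨y, rfl⟩
    change m x (m y y) ∈ K
    rw [hL]
    exact hsym _ _
  let ρ : (L ⧸ K) →ₗ[F] L →ₗ[F] L := K.liftQ m hK0
  have hρ : ∀ x, ρ (K.mkQ x) = m x := fun x => by simp [ρ]
  have hρs : ∀ a, K ≤ K.comap (ρ a) := by
    intro a
    obtain ⟨x, rfl⟩ := K.mkQ_surjective a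
    rw [hρ]; exact hKs x
  let br : (L ⧸ K) → (L ⧸ K) →ₗ[F] (L ⧸ K) := fun a => K.mapQ K (ρ a) (hρs a)
  have hbr : ∀ x y, br (K.mkQ x) (K.mkQ y) = K.mkQ (m x y) := by
    intro x y
    change K.mapQ K (ρ (K.mkQ x)) _ (Submodule.Quotient.mk y) = _
    rw [Submodule.mapQ_apply, hρ]; rfl
  have hsurj := K.mkQ_surjective
  letI lr : LieRing (L ⧸ K) :=
    { (inferInstance : AddCommGroup (L ⧸ K)) with
      bracket := fun a b => br a b
      add_lie := by
        intro a b c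
        obtain ⟨x, rfl⟩ := hsurj a
        obtain ⟨y, rfl⟩ := hsurj b
        obtain ⟨z, rfl⟩ := hsurj c
        change br (K.mkQ x + K.mkQ y) (K.mkQ z) = br (K.mkQ x) (K.mkQ z) + br (K.mkQ y) (K.mkQ z)
        rw [← map_add, hbr, hbr, hbr, ← map_add]; simp
      lie_add := fun a b c => (br a).map_add b c
      lie_self := by
        intro a
        obtain ⟨x, rfl⟩ := hsurj a
        change br (K.mkQ x) (K.mkQ x) = 0
        rw [hbr]
        simpa using hsq x
      leibniz_lie := by
        intro a b c
        obtain ⟨x, rfl⟩ := hsurj a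
        obtain ⟨y, rfl⟩ := hsurj b
        obtain ⟨z, rfl⟩ := hsurj c
        change br (K.mkQ x) (br (K.mkQ y) (K.mkQ z)) = br (br (K.mkQ x) (K.mkQ y)) (K.mkQ z)
          + br (K.mkQ y) (br (K.mkQ x) (K.mkQ z))
        simp only [hbr]
        rw [← map_add, hL] }
  letI la : LieAlgebra F (L ⧸ K) :=
    { (inferInstance : Module F (L ⧸ K)) with
      lie_smul := fun t a b => (br a).map_smul t b }
  letI lm : LieRingModule (L ⧸ K) L :=
    { bracket := fun a y => ρ a y
      add_lie := fun a b y => by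
        change ρ (a + b) y = ρ a y + ρ b y
        rw [map_add]; rfl
      lie_add := fun a y z => (ρ a).map_add y z
      leibniz_lie := by
        intro a b z
        obtain ⟨x, rfl⟩ := hsurj a
        obtain ⟨y, rfl⟩ := hsurj b
        change ρ (K.mkQ x) (ρ (K.mkQ y) z) = ρ (br (K.mkQ x) (K.mkQ y)) z
          + ρ (K.mkQ y) (ρ (K.mkQ x) z)
        rw [hbr]
        simp only [hρ]
        exact hL x y z }
  letI lmm : LieModule F (L ⧸ K) L :=
    { smul_lie := fun t a y => by
        change ρ (t • a) y = t • ρ a y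
        rw [map_smul]; rfl
      lie_smul := fun t a y => (ρ a).map_smul t y }
  refine ⟨L ⧸ K, lr, la, lm, lmm, K.mkQ, hsurj, K.ker_mkQ, fun x y => ?_, fun x y => ?_⟩
  · change ρ (K.mkQ x) y = _
    rw [hρ, hm]
  · exact (hbr x y).symm

theorem simple_of_def {F : Type v} [Field F] {g : Type u} [LieRing g] [LieAlgebra F g]
    (h : IsSimpleLieDef F g) : LieAlgebra.IsSimple F g where
  non_abelian := by
    intro hab
    obtain ⟨⟨x, y, hxy⟩, -⟩ := h
    exact hxy (hab.trivial x y)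
  eq_bot_or_eq_top := by
    intro I
    rcases h.2 I.toSubmodule (fun x a ha => ⟨I.lie_mem ha, by
      have := I.lie_mem (x := x) ha
      change ⁅a, x⁆ ∈ I.toSubmodule
      rw [← lie_skew]; exact I.toSubmodule.neg_mem this⟩) with h | h
    · left; simpa using h
    · right; simpa using h

end Construct

section Main

variable {F : Type v} [Field F] [CharZero F]

theorem weyl_complete {g : Type u} [LieRing g] [LieAlgebra F g] [FiniteDimensional F g]
    [LieAlgebra.IsSimple F g] {V : Type w} [AddCommGroup V] [Module F V]
    [LieRingModule g V] [LieModule F g V] [FiniteDimensional F V] :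
    IsCompletelyReducibleLieModule F g V := by
  intro N hN
  obtain ⟨p, h1, h2, h3⟩ := weyl_proj N hN
  refine ⟨LinearMap.ker p, fun x n hn => ?_, ?_, ?_⟩
  · rw [LinearMap.mem_ker] at hn ⊢
    rw [h3, hn, lie_zero]
  · rw [eq_bot_iff]
    rintro x ⟨hx, hx'⟩
    have : p x = 0 := hx'
    rw [h2 x hx] at this
    simp [this]
  · rw [eq_top_iff]
    rintro x -
    rw [Submodule.mem_sup]
    refine ⟨p x, h1 x, x - p x, ?_, by abel⟩
    rw [LinearMap.mem_ker, map_sub, h2 _ (h1 x), sub_self]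

theorem forward_dir
    {L : Type u} [AddCommGroup L] [Module F L] (mul : L → L → L)
    (hbil : IsBilinearMul F mul) (hleib : IsLeftLeibnizMul mul)
    (hfd : FiniteDimensional F L) (hs : IsLieSimpleLeibniz F mul) :
      ∃ (g : Type u) (_ : LieRing g) (_ : LieAlgebra F g)
        (M : Type u) (_ : AddCommGroup M) (_ : Module F M)
        (_ : LieRingModule g M) (_ : LieModule F g M),
        FiniteDimensional F g ∧ IsSimpleLieDef F g ∧
        FiniteDimensional F M ∧ IsCompletelyReducibleLieModule F g M ∧
        HasNoTrivialLieSubmodule F g M ∧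
        ∃ e : L ≃ₗ[F] g × M, ∀ x y : L, e (mul x y) = hemiMul (e x) (e y) := by
  obtain ⟨g, _, _, _, _, π, hsurj, hker, hact, hmul⟩ := hom_quot mul hbil hleib
  have hfg : FiniteDimensional F g := Module.Finite.of_surjective π hsurj
  have hsd : IsSimpleLieDef F g := by
    constructor
    · by_contra hcon
      push Not at hcon
      apply hs.2.not_ge
      rw [derivedSub, Submodule.span_le]
      rintro _ ⟨x, y, rfl⟩
      rw [← hker]
      change π _ = 0
      rw [hmul]
      exact hcon _ _
    · intro I hI
      have := hs.1 (I.comap π) (fun x a ha => by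
          have ha : π a ∈ I := ha
          have := hI (π x) _ ha
          simp only [← hmul] at this
          exact this) (by
          rw [← hker]
          intro x hx
          have : π x = 0 := hx
          simp [this])
      rcases this with h | h
      · left
        rw [eq_bot_iff]
        intro a ha
        obtain ⟨x, rfl⟩ := hsurj a
        have : x ∈ I.comap π := ha
        rw [h, ← hker] at this
        exact this
      · right
        rw [eq_top_iff]
        rintro a -
        obtain ⟨x, rfl⟩ := hsurj a
        have : x ∈ I.comap π := by rw [h]; trivial
        exact this
  have : LieAlgebra.IsSimple F g := simple_of_def hsd
  have hKs : ∀ (a : g), ∀ n ∈ leibKer F mul, ⁅a, n⁆ ∈ leibKer F mul := by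
    intro a n hn
    obtain ⟨x, rfl⟩ := hsurj a
    rw [← hker] at hn ⊢
    have hn : π n = 0 := hn
    change π _ = 0
    rw [hact, hmul, hn, lie_zero]
  let M : LieSubmodule F g L := { leibKer F mul with lie_mem := fun {a n} hn => hKs a n hn }
  have hM : ∀ x, x ∈ M ↔ π x = 0 := by
    intro x
    change x ∈ leibKer F mul ↔ _
    rw [← hker]; rfl
  have hfM : FiniteDimensional F M := inferInstanceAs (FiniteDimensional F M.toSubmodule)
  obtain ⟨p, h1, h2, h3⟩ := weyl_proj (g := g) (leibKer F mul) hKs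
  let p' : L →ₗ[F] M := LinearMap.codRestrict M.toSubmodule p h1
  have hp' : ∀ x, (p' x : L) = p x := fun x => rfl
  have hp3 : ∀ (a : g) x, p' ⁅a, x⁆ = ⁅a, p' x⁆ := by
    intro a x
    ext1
    rw [hp', h3]; rfl
  have hpM : ∀ m : M, p' m = m := by
    intro m
    ext1
    rw [hp', h2 _ m.2]
  refine ⟨g, inferInstance, inferInstance, M, inferInstance, inferInstance, inferInstance,
    inferInstance, hfg, hsd, hfM, weyl_complete, ?_, ?_⟩
  · intro T hT htr
    obtain ⟨q, q1, q2, q3⟩ := weyl_proj T hT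
    have key : leibKer F mul ≤ LinearMap.ker (q ∘ₗ p') := by
      rw [leibKer, Submodule.span_le]
      rintro _ ⟨x, rfl⟩
      change q (p' (mul x x)) = 0
      rw [← hact, hp3, q3]
      exact htr _ _ (q1 _)
    rw [eq_bot_iff]
    intro n hn
    have : q (p' (n : L)) = 0 := key n.2
    rw [hpM, q2 n hn] at this
    simpa using this
  · let e0 : L →ₗ[F] g × M := π.prod p'
    have hinj : Function.Injective e0 := by
      rw [← LinearMap.ker_eq_bot, eq_bot_iff]
      intro x hx
      have hx : (π x, p' x) = 0 := hx
      have ha : π x = 0 := congrArg Prod.fst hx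
      have hb : p' x = 0 := congrArg Prod.snd hx
      have hc : p' x = ⟨x, (hM x).2 ha⟩ := hpM ⟨x, (hM x).2 ha⟩
      rw [hb] at hc
      exact (congrArg Subtype.val hc).symm
    have hsj : Function.Surjective e0 := by
      rintro ⟨a, m⟩
      obtain ⟨y, rfl⟩ := hsurj a
      refine ⟨y - p' y + m, ?_⟩
      change (π _, p' _) = _
      have e1 : ∀ m : M, π (m : L) = 0 := fun m => (hM _).1 m.2
      rw [map_add, map_add, map_sub, map_sub, e1, e1, hpM, hpM]
      simp
    refine ⟨LinearEquiv.ofBijective e0 ⟨hinj, hsj⟩, fun x y => ?_⟩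
    change (π _, p' _) = (⁅π x, π y⁆, ⁅π x, p' y⁆)
    rw [hmul, ← hact, hp3]

theorem backward_dir
    {L : Type u} [AddCommGroup L] [Module F L] (mul : L → L → L)
    {g : Type u} [LieRing g] [LieAlgebra F g]
    {M : Type u} [AddCommGroup M] [Module F M] [LieRingModule g M] [LieModule F g M]
    (hg : FiniteDimensional F g) (hsd : IsSimpleLieDef F g)
    (hfM : FiniteDimensional F M) (hcr : IsCompletelyReducibleLieModule F g M)
    (hnt : HasNoTrivialLieSubmodule F g M)
    (e : L ≃ₗ[F] g × M) (he : ∀ x y : L, e (mul x y) = hemiMul (e x) (e y)) :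
    FiniteDimensional F L ∧ IsLieSimpleLeibniz F mul := by
  have hm : ∀ x y, mul x y = e.symm (hemiMul (e x) (e y)) := by
    intro x y; rw [← he]; simp
  have hmem : ∀ m : M, e.symm (0, m) ∈ leibKer F mul := by
    let P : Submodule F M := gModSpan F g M
    have hin : ∀ (x : g) (m : M), ⁅x, m⁆ ∈ P := fun x m => Submodule.subset_span ⟨x, m, rfl⟩
    obtain ⟨N, hN, hi, hsup⟩ := hcr P (fun x n _ => hin x n)
    have hN0 : N = ⊥ := by
      apply hnt N hN
      intro x n hn
      have : ⁅x, n⁆ ∈ P ⊓ N := ⟨hin x n, hN x n hn⟩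
      rw [hi] at this
      simpa using this
    have hP : P = ⊤ := by rw [← hsup, hN0]; simp
    have : P ≤ (leibKer F mul).comap (e.symm.toLinearMap ∘ₗ LinearMap.inr F g M) := by
      change Submodule.span F _ ≤ _
      rw [Submodule.span_le]
      rintro _ ⟨x, n, rfl⟩
      refine Submodule.subset_span ⟨e.symm (x, n), ?_⟩
      rw [hm]
      simp [hemiMul]
    intro m
    have hmP : m ∈ P := by rw [hP]; trivial
    exact this hmP
  have hK : ∀ x, x ∈ leibKer F mul ↔ (e x).1 = 0 := by
    intro x
    constructor
    · intro hx
      have : leibKer F mul ≤ LinearMap.ker (LinearMap.fst F g M ∘ₗ e.toLinearMap) := by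
        rw [leibKer, Submodule.span_le]
        rintro _ ⟨x, rfl⟩
        change (e (mul x x)).1 = 0
        rw [he]; simp [hemiMul]
      exact this hx
    · intro hx
      have := hmem (e x).2
      rw [← hx] at this
      simpa using this
  refine ⟨Module.Finite.equiv e.symm, ?_, ?_⟩
  · intro I hI hle
    have h0 := hsd.2 (I.map (LinearMap.fst F g M ∘ₗ e.toLinearMap)) (by
      rintro x _ ⟨a, ha, rfl⟩
      have := hI (e.symm (x, 0)) a ha
      refine ⟨⟨_, this.1, ?_⟩, ⟨_, this.2, ?_⟩⟩
      · change (e (mul _ _)).1 = ⁅x, (e a).1⁆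
        rw [he]; simp [hemiMul]
      · change (e (mul _ _)).1 = ⁅(e a).1, x⁆
        rw [he]; simp [hemiMul])
    rcases h0 with h | h
    · left
      refine le_antisymm (fun x hx => ?_) hle
      rw [hK]
      have : (e x).1 ∈ I.map (LinearMap.fst F g M ∘ₗ e.toLinearMap) := ⟨x, hx, rfl⟩
      rw [h] at this
      simpa using this
    · right
      rw [eq_top_iff]
      rintro x -
      have : (e x).1 ∈ I.map (LinearMap.fst F g M ∘ₗ e.toLinearMap) := by rw [h]; trivial
      obtain ⟨y, hy, hyx⟩ := this
      have hyx : (e y).1 = (e x).1 := hyx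
      have : x - y ∈ leibKer F mul := by
        rw [hK, map_sub, Prod.fst_sub, hyx, sub_self]
      have := I.add_mem (hle this) hy
      simpa using this
  · rw [lt_iff_le_and_ne]
    constructor
    · rw [leibKer, Submodule.span_le]
      rintro _ ⟨x, rfl⟩
      exact Submodule.subset_span ⟨x, x, rfl⟩
    · intro heq
      obtain ⟨⟨x, y, hxy⟩, -⟩ := hsd
      apply hxy
      have : mul (e.symm (x, 0)) (e.symm (y, 0)) ∈ derivedSub F mul :=
        Submodule.subset_span ⟨_, _, rfl⟩
      rw [← heq, hK, he] at this
      simpa [hemiMul] using this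

end Main

/-- In characteristic zero, a left Leibniz algebra `L` is
finite-dimensional Lie-simple if, and only if, it is isomorphic to the left
hemi-semidirect product of a finite-dimensional simple Lie algebra `g` and a
finite-dimensional completely reducible left `g`-module `M` containing no non-zero
trivial `g`-submodule. -/
theorem lieSimple_structure_theorem (F : Type v) [Field F] [CharZero F]
    (L : Type u) [AddCommGroup L] [Module F L] (mul : L → L → L)
    (hbil : IsBilinearMul F mul) (hleib : IsLeftLeibnizMul mul) :
    (FiniteDimensional F L ∧ IsLieSimpleLeibniz F mul) ↔
      ∃ (g : Type u) (_ : LieRing g) (_ : LieAlgebra F g)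
        (M : Type u) (_ : AddCommGroup M) (_ : Module F M)
        (_ : LieRingModule g M) (_ : LieModule F g M),
        FiniteDimensional F g ∧ IsSimpleLieDef F g ∧
        FiniteDimensional F M ∧ IsCompletelyReducibleLieModule F g M ∧
        HasNoTrivialLieSubmodule F g M ∧
        ∃ e : L ≃ₗ[F] g × M, ∀ x y : L, e (mul x y) = hemiMul (e x) (e y) := by
  constructor
  · rintro ⟨h1, h2⟩
    exact forward_dir mul hbil hleib h1 h2
  · rintro ⟨g, _, _, M, _, _, _, _, h1, h2, h3, h4, h5, e, he⟩
    exact backward_dir mul h1 h2 h3 h4 h5 e he
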